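/- Let G be a hyperbolic group with finite generating set Σ and let H ⊆ G be a quasiconvex subgroup with [G : H] = ∞. Then there exists a constant C₂ > 0 such that for every g ∈ G there exist g' ∈ G and a geodesic ray r from 1 in the Cayley graph passing through g' with d(g, g') < C₂ and with d(r(t), H) unbounded as t → ∞. -/

import Mathlib

section Preamble

variable {G : Type*} [Group G]

/-- The word length of `g : G` with respect to the generating set `S`. -/
noncomputable def wordLength (S : Set G) (g : G) : ℕ :=
  sInf {n | ∃ w : List G, (∀ x ∈ w, x ∈ S) ∧ w.length = n ∧ w.prod = g}

/-- The word metric `d(x, y) = |x⁻¹ y|` on the Cayley graph of `G`. -/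
noncomputable def wordDist (S : Set G) (x y : G) : ℕ := wordLength S (x⁻¹ * y)

/-- `S` is a finite generating set of `G` closed under inversion. -/
def IsGenSet (S : Set G) : Prop :=
  S.Finite ∧ (∀ x ∈ S, x⁻¹ ∈ S) ∧ Subgroup.closure S = ⊤

/-- `γ`, restricted to `{0, …, n}`, is a geodesic segment in the Cayley graph. -/
def IsGeodesicSegment (S : Set G) (γ : ℕ → G) (n : ℕ) : Prop :=
  ∀ i j, i ≤ n → j ≤ n → wordDist S (γ i) (γ j) = Nat.dist i j

/-- `r : ℕ → G` is a geodesic ray in the Cayley graph. -/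
def IsGeodesicRay (S : Set G) (r : ℕ → G) : Prop :=
  ∀ i j, wordDist S (r i) (r j) = Nat.dist i j

/-- Every geodesic triangle in the Cayley graph of `G` is `δ`-thin: each side lies in
the `δ`-neighborhood of the union of the other two sides. -/
def IsDeltaHyperbolic (S : Set G) (δ : ℕ) : Prop :=
  ∀ (γ₁ γ₂ γ₃ : ℕ → G) (n₁ n₂ n₃ : ℕ),
    IsGeodesicSegment S γ₁ n₁ → IsGeodesicSegment S γ₂ n₂ → IsGeodesicSegment S γ₃ n₃ →
    γ₁ 0 = γ₃ 0 → γ₁ n₁ = γ₂ 0 → γ₂ n₂ = γ₃ n₃ →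
    ∀ k ≤ n₃, ∃ i, (i ≤ n₁ ∧ wordDist S (γ₃ k) (γ₁ i) ≤ δ) ∨
      (i ≤ n₂ ∧ wordDist S (γ₃ k) (γ₂ i) ≤ δ)

/-- `G` is hyperbolic with respect to `S`: some `δ` makes all triangles `δ`-thin. -/
def IsHyperbolic (S : Set G) : Prop := ∃ δ : ℕ, IsDeltaHyperbolic S δ

/-- `H` is a `K`-quasiconvex subgroup: every geodesic between points of `H`
lies in the `K`-neighborhood of `H`. -/
def IsQuasiconvex (S : Set G) (H : Subgroup G) (K : ℕ) : Prop :=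
  ∀ (γ : ℕ → G) (n : ℕ), IsGeodesicSegment S γ n → γ 0 ∈ H → γ n ∈ H →
    ∀ i ≤ n, ∃ h ∈ H, wordDist S (γ i) h ≤ K

/-- Property (*): there is a set-theoretic section `s : G/H → G` of the coset
projection whose image is a net in `G` for the word metric of `S`. -/
def SatisfiesStar (S : Set G) (H : Subgroup G) : Prop :=
  ∃ s : G ⧸ H → G, (∀ q : G ⧸ H, (QuotientGroup.mk (s q) : G ⧸ H) = q) ∧
    ∃ C : ℕ, ∀ g : G, ∃ q : G ⧸ H, wordDist S g (s q) ≤ C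

/-- A hyperbolic group is elementary if it is finite or has an infinite cyclic
subgroup of finite index. -/
def IsElementary (G : Type*) [Group G] : Prop :=
  Finite G ∨ ∃ H : Subgroup G, IsCyclic H ∧ Infinite H ∧ H.index ≠ 0

end Preamble

section Helpers

open Filter

variable {G : Type*} [Group G] {S : Set G}

lemma aux_wl_prod_le (w : List G) (hw : ∀ x ∈ w, x ∈ S) : wordLength S w.prod ≤ w.length :=
  Nat.sInf_le ⟨w, hw, rfl, rfl⟩

lemma aux_exists_word (hGen : IsGenSet S) (g : G) :
    ∃ w : List G, (∀ x ∈ w, x ∈ S) ∧ w.length = wordLength S g ∧ w.prod = g := by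
  have hne : {n | ∃ w : List G, (∀ x ∈ w, x ∈ S) ∧ w.length = n ∧ w.prod = g}.Nonempty := by
    have hg : g ∈ Subgroup.closure S := by rw [hGen.2.2]; trivial
    rw [← Subgroup.mem_toSubmonoid, Subgroup.closure_toSubmonoid] at hg
    obtain ⟨l, hl, hp⟩ := Submonoid.exists_list_of_mem_closure hg
    refine ⟨l.length, l, ?_, rfl, hp⟩
    intro x hx
    rcases hl x hx with h | h
    · exact h
    · simpa using hGen.2.1 _ h
  exact Nat.sInf_mem hne

lemma aux_wl_one : wordLength S (1 : G) = 0 := by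
  have := aux_wl_prod_le (S := S) ([] : List G) (by simp)
  simpa using this

lemma aux_wl_mul (hGen : IsGenSet S) (a b : G) :
    wordLength S (a * b) ≤ wordLength S a + wordLength S b := by
  obtain ⟨w, hw, hl, hp⟩ := aux_exists_word hGen a
  obtain ⟨v, hv, hl', hp'⟩ := aux_exists_word hGen b
  have := aux_wl_prod_le (S := S) (w ++ v) (by
    intro x hx
    rcases List.mem_append.1 hx with h | h
    · exact hw x h
    · exact hv x h)
  rw [List.prod_append, List.length_append, hp, hp', hl, hl'] at this
  exact this

lemma aux_wl_inv_le (hGen : IsGenSet S) (a : G) : wordLength S a⁻¹ ≤ wordLength S a := by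
  obtain ⟨w, hw, hl, hp⟩ := aux_exists_word hGen a
  have := aux_wl_prod_le (S := S) (w.map (fun x => x⁻¹)).reverse (by
    intro x hx
    simp only [List.mem_reverse, List.mem_map] at hx
    obtain ⟨y, hy, rfl⟩ := hx
    exact hGen.2.1 _ (hw y hy))
  rw [← List.prod_inv_reverse, hp] at this
  simpa [hl] using this

lemma aux_self (x : G) : wordDist S x x = 0 := by
  simp [wordDist, aux_wl_one]

lemma aux_comm (hGen : IsGenSet S) (x y : G) : wordDist S x y = wordDist S y x := by
  unfold wordDist
  apply le_antisymm
  · have := aux_wl_inv_le hGen (y⁻¹ * x)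
    simpa using this
  · have := aux_wl_inv_le hGen (x⁻¹ * y)
    simpa using this

lemma aux_tri (hGen : IsGenSet S) (x y z : G) :
    wordDist S x z ≤ wordDist S x y + wordDist S y z := by
  have := aux_wl_mul hGen (x⁻¹ * y) (y⁻¹ * z)
  unfold wordDist
  simpa [mul_assoc] using this

lemma aux_left (a x y : G) : wordDist S (a * x) (a * y) = wordDist S x y := by
  unfold wordDist
  congr 1
  group

lemma aux_geod (hGen : IsGenSet S) (x y : G) :
    ∃ γ : ℕ → G, IsGeodesicSegment S γ (wordDist S x y) ∧ γ 0 = x ∧ γ (wordDist S x y) = y := by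
  obtain ⟨w, hw, hl, hp⟩ := aux_exists_word hGen (x⁻¹ * y)
  change w.length = wordDist S x y at hl
  have hend : x * (w.take (wordDist S x y)).prod = y := by
    rw [← hl, List.take_length, hp]; group
  have hup : ∀ i j, i ≤ j → wordDist S (x * (w.take i).prod) (x * (w.take j).prod) ≤ j - i := by
    intro i j hij
    have h1 : w.take j = w.take i ++ (w.take j).drop i := by
      conv_lhs => rw [← List.take_append_drop i (w.take j)]
      rw [List.take_take, min_eq_left hij]
    rw [aux_left, h1, List.prod_append]
    unfold wordDist
    rw [inv_mul_cancel_left]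
    refine (aux_wl_prod_le _ ?_).trans ?_
    · intro z hz
      exact hw z (List.mem_of_mem_take (List.mem_of_mem_drop hz))
    · simp only [List.length_drop, List.length_take]
      omega
  have key : ∀ i j, i ≤ j → j ≤ wordDist S x y →
      wordDist S (x * (w.take i).prod) (x * (w.take j).prod) = j - i := by
    intro i j hij hj
    have h1 := hup i j hij
    have h0 := hup 0 i (Nat.zero_le _)
    have h2 := hup j _ hj
    rw [hend] at h2
    simp only [List.take_zero, List.prod_nil, mul_one] at h0
    have t1 := aux_tri hGen x (x * (w.take i).prod) y
    have t2 := aux_tri hGen (x * (w.take i).prod) (x * (w.take j).prod) y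
    omega
  refine ⟨fun i => x * (w.take i).prod, ?_, by simp, hend⟩
  intro i j hi hj
  rcases le_total i j with h | h
  · rw [Nat.dist_eq_sub_of_le h]
    exact key i j h hj
  · rw [Nat.dist_eq_sub_of_le_right h, aux_comm hGen]
    exact key j i h hi

lemma aux_seg_mono {γ : ℕ → G} {n m : ℕ} (h : IsGeodesicSegment S γ n) (hm : m ≤ n) :
    IsGeodesicSegment S γ m :=
  fun i j hi hj => h i j (hi.trans hm) (hj.trans hm)

lemma aux_seg_left {γ : ℕ → G} {n : ℕ} (a : G) (h : IsGeodesicSegment S γ n) :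
    IsGeodesicSegment S (fun i => a * γ i) n := by
  intro i j hi hj
  simp only [aux_left]
  exact h i j hi hj

lemma aux_ball_finite (hGen : IsGenSet S) (n : ℕ) : {g : G | wordLength S g ≤ n}.Finite := by
  have h1 : {l : List S | l.length ≤ n}.Finite := by
    have : Finite S := hGen.1
    exact List.finite_length_le S n
  refine (h1.image (fun l => (l.map Subtype.val).prod)).subset ?_
  intro g hg
  obtain ⟨w, hw, hl, hp⟩ := aux_exists_word hGen g
  refine ⟨w.attach.map (fun x => ⟨x.1, hw _ x.2⟩), ?_, ?_⟩
  · simpa [hl] using hg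
  · simp [List.map_map, Function.comp_def, hp]

/-- Limits of longer and longer geodesic segments starting at `1`. -/
lemma aux_konig (hGen : IsGenSet S) (γ : ℕ → ℕ → G) (L : ℕ → ℕ) (hL : ∀ n, n ≤ L n)
    (hγ : ∀ n, IsGeodesicSegment S (γ n) (L n)) (h0 : ∀ n, γ n 0 = 1) :
    ∃ r : ℕ → G, IsGeodesicRay S r ∧ r 0 = 1 ∧ (∀ i, ∃ n, i ≤ n ∧ r i = γ n i) ∧
      ∀ (p : G) (D N : ℕ), (∀ n, N ≤ n → ∃ t, t ≤ L n ∧ wordDist S p (γ n t) ≤ D) →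
        ∃ t, wordDist S p (r t) ≤ D := by
  let U : Ultrafilter ℕ := hyperfilter ℕ
  have hU : ∀ N : ℕ, ∀ᶠ n in (U : Filter ℕ), N ≤ n := by
    intro N
    have := Nat.hyperfilter_le_atTop (eventually_ge_atTop N)
    exact this
  have hex : ∀ i, ∃ g, ∀ᶠ n in (U : Filter ℕ), γ n i = g := by
    intro i
    have : ∀ᶠ n in (U : Filter ℕ), ∃ g ∈ {g : G | wordLength S g ≤ i}, γ n i = g := by
      filter_upwards [hU i] with n hn
      refine ⟨_, ?_, rfl⟩
      have := hγ n 0 i (Nat.zero_le _) (hn.trans (hL n))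
      rw [h0, Nat.dist_eq_sub_of_le (Nat.zero_le _)] at this
      simp [wordDist] at this
      exact this.le
    rw [Ultrafilter.eventually_exists_mem_iff (aux_ball_finite hGen i)] at this
    obtain ⟨g, -, hg⟩ := this
    exact ⟨g, hg⟩
  choose r hr using hex
  refine ⟨r, ?_, ?_, ?_, ?_⟩
  · intro i j
    obtain ⟨n, ⟨⟨hi, hj⟩, h3⟩, h4⟩ := ((((hr i).and (hr j)).and (hU i)).and (hU j)).exists
    rw [← hi, ← hj]
    exact hγ n i j (h3.trans (hL n)) (h4.trans (hL n))
  · obtain ⟨n, hn⟩ := (hr 0).exists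
    rw [← hn, h0]
  · intro i
    obtain ⟨n, hn, h⟩ := ((hr i).and (hU i)).exists
    exact ⟨n, h, hn.symm⟩
  · intro p D N h
    have : ∀ᶠ n in (U : Filter ℕ), ∃ t ∈ Set.Iic (wordDist S 1 p + D),
        wordDist S p (γ n t) ≤ D := by
      filter_upwards [hU N] with n hn
      obtain ⟨t, ht, hd⟩ := h n hn
      refine ⟨t, ?_, hd⟩
      have h1 := hγ n 0 t (Nat.zero_le _) ht
      rw [h0, Nat.dist_eq_sub_of_le (Nat.zero_le _)] at h1
      have h2 := aux_tri hGen 1 p (γ n t)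
      simp only [Set.mem_Iic]
      omega
    rw [Ultrafilter.eventually_exists_mem_iff (Set.finite_Iic _)] at this
    obtain ⟨t, -, ht⟩ := this
    obtain ⟨n, h1, h2⟩ := (ht.and (hr t)).exists
    exact ⟨t, h2 ▸ h1⟩

lemma aux_far (hGen : IsGenSet S) (H : Subgroup G) (hInd : H.index = 0) (n : ℕ) :
    ∃ x : G, ∀ h ∈ H, n < wordDist S x h := by
  by_contra hcon
  push Not at hcon
  have hfin := aux_ball_finite hGen n
  have hsurj : ((fun u : G => (QuotientGroup.mk u : G ⧸ H)) '' {g : G | wordLength S g ≤ n})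
      = Set.univ := by
    rw [Set.eq_univ_iff_forall]
    intro q
    induction q using QuotientGroup.induction_on with
    | H z =>
      obtain ⟨h, hh, hd⟩ := hcon z⁻¹
      refine ⟨z * h, by simpa [wordDist] using hd, ?_⟩
      simp only [QuotientGroup.eq]
      simpa using H.inv_mem hh
  have : Finite (G ⧸ H) := by
    rw [← Set.finite_univ_iff, ← hsurj]
    exact hfin.image _
  exact Subgroup.index_ne_zero_of_finite hInd

/-- A ray leaving `H` orthogonally. -/
lemma aux_perp (hGen : IsGenSet S) (H : Subgroup G) (hInd : H.index = 0) :
    ∃ ρ : ℕ → G, IsGeodesicRay S ρ ∧ ρ 0 = 1 ∧ ∀ t, ∀ h ∈ H, t ≤ wordDist S (ρ t) h := by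
  have hx : ∀ n : ℕ, ∃ x : G, n ≤ wordDist S 1 x ∧ ∀ h ∈ H, wordDist S 1 x ≤ wordDist S x h := by
    intro n
    obtain ⟨x, hx⟩ := aux_far hGen H hInd n
    obtain ⟨⟨h₀, hh₀⟩, hmin⟩ : ∃ a : H, ∀ b : H, wordDist S x a ≤ wordDist S x b :=
      ⟨Function.argmin (fun h : H => wordDist S x h),
        fun b => Function.argmin_le (fun h : H => wordDist S x h) b⟩
    have e : wordDist S 1 (h₀⁻¹ * x) = wordDist S x h₀ := by
      rw [← aux_left h₀, mul_inv_cancel_left, mul_one, aux_comm hGen]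
    refine ⟨h₀⁻¹ * x, ?_, ?_⟩
    · rw [e]
      exact (hx h₀ hh₀).le
    · intro h hh
      rw [e, ← aux_left h₀ (h₀⁻¹ * x), mul_inv_cancel_left]
      exact hmin ⟨h₀ * h, H.mul_mem hh₀ hh⟩
  choose x hx1 hx2 using hx
  choose γ hγ h0 h1 using fun n => aux_geod hGen 1 (x n)
  obtain ⟨ρ, hρ, hρ0, hρi, -⟩ := aux_konig hGen γ (fun n => wordDist S 1 (x n)) hx1 hγ h0
  refine ⟨ρ, hρ, hρ0, ?_⟩
  intro t h hh
  obtain ⟨n, hn, he⟩ := hρi t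
  have h2 := hγ n t (wordDist S 1 (x n)) (hn.trans (hx1 n)) le_rfl
  rw [h1, Nat.dist_eq_sub_of_le (hn.trans (hx1 n))] at h2
  have h3 := hx2 n h hh
  have h4 := aux_tri hGen (x n) (γ n t) h
  rw [aux_comm hGen (x n) (γ n t)] at h4
  have h5 := hn.trans (hx1 n)
  rw [he]
  omega

end Helpers

/-- For a hyperbolic `G` and quasiconvex `H` of infinite index,
there is `C₂ > 0` such that every `g` is within `C₂` of a point `g'` on a geodesic
ray from `1` whose distance to `H` is unbounded. -/
theorem statement_17 {G : Type*} [Group G] (S : Set G) (hGen : IsGenSet S)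
    (hHyp : IsHyperbolic S) (H : Subgroup G) (hQC : ∃ K : ℕ, IsQuasiconvex S H K)
    (hInd : H.index = 0) :
    ∃ C₂ : ℕ, 0 < C₂ ∧ ∀ g : G, ∃ (g' : G) (r : ℕ → G),
      IsGeodesicRay S r ∧ r 0 = 1 ∧ (∃ t : ℕ, r t = g') ∧ wordDist S g g' < C₂ ∧
      ∀ M : ℕ, ∃ t : ℕ, ∀ h ∈ H, M < wordDist S (r t) h := by
  obtain ⟨δ, hδ⟩ := hHyp
  obtain ⟨K, hK⟩ := hQC
  obtain ⟨ρ, hρ, hρ0, hρH⟩ := aux_perp hGen H hInd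
  refine ⟨2 * K + 4 * δ + 2, by omega, ?_⟩
  intro g
  by_cases hg : ∃ h ∈ H, wordDist S g h ≤ K + 2 * δ
  · -- `g` is close to `H`
    obtain ⟨h, hh, hgh⟩ := hg
    have hlen : ∀ n, n ≤ wordDist S 1 (h * ρ (n + wordDist S 1 h)) := by
      intro n
      have h1 := aux_tri hGen h 1 (h * ρ (n + wordDist S 1 h))
      have h2 := aux_left (S := S) h 1 (ρ (n + wordDist S 1 h))
      have h3 := hρ 0 (n + wordDist S 1 h)
      rw [hρ0, Nat.dist_eq_sub_of_le (Nat.zero_le _)] at h3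
      rw [mul_one] at h2
      rw [aux_comm hGen h 1] at h1
      omega
    choose γ hγ h0 h1 using fun n => aux_geod hGen 1 (h * ρ (n + wordDist S 1 h))
    obtain ⟨r, hr, hr0, -, hrp⟩ := aux_konig hGen γ _ hlen hγ h0
    -- `r` passes near each far enough point of `h ρ`
    have hnear : ∀ s, K + δ < s → ∃ t, wordDist S (h * ρ s) (r t) ≤ δ := by
      intro s hs
      apply hrp _ _ s
      intro n hn
      obtain ⟨β, hβ, hβ0, hβ1⟩ := aux_geod hGen h 1
      obtain ⟨i, hi⟩ := hδ β (γ n) (fun i => h * ρ i) _ _ (n + wordDist S 1 h) hβ (hγ n)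
        (aux_seg_left h fun i j _ _ => hρ i j) (by simp [hβ0, hρ0]) (by rw [hβ1, h0]) (h1 n)
        s (by omega)
      rcases hi with ⟨hi, hd⟩ | ⟨hi, hd⟩
      · exfalso
        obtain ⟨k, hk, hkd⟩ := hK β _ hβ (by rw [hβ0]; exact hh) (by rw [hβ1]; exact H.one_mem) i hi
        have e1 := hρH s (h⁻¹ * k) (H.mul_mem (H.inv_mem hh) hk)
        rw [← aux_left h, mul_inv_cancel_left] at e1
        have e2 := aux_tri hGen (h * ρ s) (β i) k
        omega
      · exact ⟨i, hi, hd⟩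
    obtain ⟨t, ht⟩ := hnear (K + δ + 1) (by omega)
    refine ⟨r t, r, hr, hr0, ⟨t, rfl⟩, ?_, ?_⟩
    · have e1 := aux_tri hGen g h (r t)
      have e2 := aux_tri hGen h (h * ρ (K + δ + 1)) (r t)
      have e3 := aux_left (S := S) h 1 (ρ (K + δ + 1))
      have e4 := hρ 0 (K + δ + 1)
      rw [hρ0, Nat.dist_eq_sub_of_le (Nat.zero_le _)] at e4
      rw [mul_one] at e3
      omega
    · intro M
      obtain ⟨t, ht⟩ := hnear (M + K + δ + 1) (by omega)
      refine ⟨t, ?_⟩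
      intro k hk
      have e1 := hρH (M + K + δ + 1) (h⁻¹ * k) (H.mul_mem (H.inv_mem hh) hk)
      rw [← aux_left h, mul_inv_cancel_left] at e1
      have e2 := aux_tri hGen (h * ρ (M + K + δ + 1)) (r t) k
      omega
  · -- `g` is far from `H`
    push Not at hg
    have hseg : ∀ n, ∃ x : G, n ≤ wordDist S 1 x ∧ ∃ γ : ℕ → G,
        IsGeodesicSegment S γ (wordDist S 1 x) ∧ γ 0 = 1 ∧
        ∃ t, t ≤ wordDist S 1 x ∧ wordDist S g (γ t) ≤ δ := by
      intro n
      let m := n + wordDist S 1 g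
      let a : G := g * (ρ m)⁻¹
      have ham : a * ρ m = g := by simp [a]
      obtain ⟨α, hα, hα0, hα1⟩ := aux_geod hGen (a * ρ 0) 1
      obtain ⟨α', hα', hα0', hα1'⟩ := aux_geod hGen 1 (a * ρ 0)
      obtain ⟨β, hβ, hβ0, hβ1⟩ := aux_geod hGen 1 (a * ρ (2 * m))
      have hd1 : wordDist S g (a * ρ 0) = m := by
        have := hρ m 0
        rw [Nat.dist_eq_sub_of_le_right (Nat.zero_le _)] at this
        rw [← ham, aux_left, this]
        simp
      have hd2 : wordDist S g (a * ρ (2 * m)) = m := by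
        have := hρ m (2 * m)
        rw [Nat.dist_eq_sub_of_le (by omega)] at this
        rw [← ham, aux_left, this]
        omega
      have hm : m = n + wordDist S 1 g := rfl
      have hl1 := aux_tri hGen g 1 (a * ρ 0)
      have hl2 := aux_tri hGen g 1 (a * ρ (2 * m))
      rw [aux_comm hGen g 1] at hl1 hl2
      -- the reversed side
      have hrev : IsGeodesicSegment S (fun i => α' (wordDist S 1 (a * ρ 0) - i))
          (wordDist S 1 (a * ρ 0)) := by
        intro i j hi hj
        have := hα' (wordDist S 1 (a * ρ 0) - i) (wordDist S 1 (a * ρ 0) - j)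
          (Nat.sub_le _ _) (Nat.sub_le _ _)
        rw [this]
        unfold Nat.dist
        omega
      obtain ⟨i, hi⟩ := hδ _ β (fun i => a * ρ i) _ _ (2 * m) hrev hβ
        (aux_seg_left a fun i j _ _ => hρ i j) (by simp [hα1']) (by simp [hα0', hβ0]) hβ1
        m (by omega)
      simp only [ham] at hi
      rcases hi with ⟨hi, hd⟩ | ⟨hi, hd⟩
      · exact ⟨a * ρ 0, by omega, α', hα', hα0', _, Nat.sub_le _ _, hd⟩
      · exact ⟨a * ρ (2 * m), by omega, β, hβ, hβ0, i, hi, hd⟩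
    choose x hx γ hγ h0 hγt using hseg
    obtain ⟨r, hr, hr0, -, hrp⟩ := aux_konig hGen γ _ hx hγ h0
    obtain ⟨t₀, ht₀⟩ := hrp g δ 0 (fun n _ => hγt n)
    refine ⟨r t₀, r, hr, hr0, ⟨t₀, rfl⟩, by omega, ?_⟩
    intro M
    refine ⟨t₀ + M + δ + 1, ?_⟩
    by_contra hcon
    push Not at hcon
    obtain ⟨h, hh, hM⟩ := hcon
    obtain ⟨α, hα, hα0, hα1⟩ := aux_geod hGen 1 h
    obtain ⟨β, hβ, hβ0, hβ1⟩ := aux_geod hGen h (r (t₀ + M + δ + 1))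
    obtain ⟨i, hi⟩ := hδ α β r _ _ (t₀ + M + δ + 1) hα hβ (fun i j _ _ => hr i j)
      (by rw [hα0, hr0]) (by rw [hα1, hβ0]) hβ1 t₀ (by omega)
    rcases hi with ⟨hi, hd⟩ | ⟨hi, hd⟩
    · obtain ⟨k, hk, hkd⟩ := hK α _ hα (by rw [hα0]; exact H.one_mem) (by rw [hα1]; exact hh) i hi
      have e1 := hg k hk
      have e2 := aux_tri hGen g (r t₀) k
      have e3 := aux_tri hGen (r t₀) (α i) k
      omega
    · have e1 := hr t₀ (t₀ + M + δ + 1)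
      rw [Nat.dist_eq_sub_of_le (by omega)] at e1
      have e2 := aux_tri hGen (r t₀) (β i) (r (t₀ + M + δ + 1))
      have e3 := hβ i _ hi le_rfl
      rw [hβ1, Nat.dist_eq_sub_of_le hi] at e3
      rw [aux_comm hGen] at hM
      omega
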